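/- Let n ≥ 2 be an integer and ξ a real number with 2n−2 < ŵ_n(ξ) < ∞, and write w = ŵ_n(ξ). For every ε > 0 there exists k_0(ε) such that for every integer k ≥ k_0(ε) satisfying H_k > 2·H_{k−1}, the integer ℓ = ℓ(k) is finite and d_3·w³ + d_2·w² + d_1·w + d_0 ≤ ε, where d_3 = τ_k, d_2 = −(2n·τ_k + n − 2), d_1 = τ_k·τ_ℓ + (n²+n−1)·τ_k + (1−n)·τ_ℓ + n² − n − 2, and d_0 = −n·((n−1+τ_ℓ)·τ_k + n − 2). -/

import Mathlib

open Polynomial Filter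

noncomputable section

/-- Height of an integer polynomial: maximum absolute value of its coefficients. -/
def polyHeight (P : Polynomial ℤ) : ℕ :=
  P.support.sup fun i => (P.coeff i).natAbs

/-- The set of exponents `w` admissible for the uniform exponent `ŵ_n(ξ)`. -/
def uniformExpSet (n : ℕ) (ξ : ℝ) : Set ℝ :=
  {w | ∀ᶠ X : ℝ in atTop, ∃ P : Polynomial ℤ, P.natDegree ≤ n ∧
    (polyHeight P : ℝ) ≤ X ∧ 0 < |Polynomial.aeval ξ P| ∧
    |Polynomial.aeval ξ P| < X ^ (-w)}

/-- The uniform exponent `ŵ_n(ξ)`, as an extended real. -/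
def wHat (n : ℕ) (ξ : ℝ) : EReal :=
  sSup ((fun w : ℝ => (w : EReal)) '' uniformExpSet n ξ)

/-- The set of exponents `w` admissible for the ordinary exponent `w_n(ξ)`. -/
def ordExpSet (n : ℕ) (ξ : ℝ) : Set ℝ :=
  {w | {P : Polynomial ℤ | P.natDegree ≤ n ∧ 0 < |Polynomial.aeval ξ P| ∧
      |Polynomial.aeval ξ P| < (polyHeight P : ℝ) ^ (-w)}.Infinite}

/-- The ordinary exponent `w_n(ξ)`, as an extended real. -/
def wOrd (n : ℕ) (ξ : ℝ) : EReal :=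
  sSup ((fun w : ℝ => (w : EReal)) '' ordExpSet n ξ)

/-- `P` (1-indexed: the relevant values are `P 1, P 2, …`) is the sequence of best
approximation polynomials associated to `(n, ξ)`. -/
structure IsBestApproxSeq (n : ℕ) (ξ : ℝ) (P : ℕ → Polynomial ℤ) : Prop where
  ne_zero : ∀ k, 1 ≤ k → P k ≠ 0
  deg_le : ∀ k, 1 ≤ k → (P k).natDegree ≤ n
  height_lt : ∀ k, 1 ≤ k → polyHeight (P k) < polyHeight (P (k+1))
  eval_lt : ∀ k, 1 ≤ k → |Polynomial.aeval ξ (P (k+1))| < |Polynomial.aeval ξ (P k)|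
  isMin : ∀ k, 1 ≤ k → ∀ Q : Polynomial ℤ, Q ≠ 0 → Q.natDegree ≤ n →
    polyHeight Q ≤ polyHeight (P k) →
    |Polynomial.aeval ξ (P k)| ≤ |Polynomial.aeval ξ Q|
  complete : ∀ Q : Polynomial ℤ, Q ≠ 0 → Q.natDegree ≤ n →
    (∀ R : Polynomial ℤ, R ≠ 0 → R.natDegree ≤ n → polyHeight R ≤ polyHeight Q →
      |Polynomial.aeval ξ Q| ≤ |Polynomial.aeval ξ R|) →
    ∃ k, 1 ≤ k ∧ (Q = P k ∨ Q = -P k)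

/-- The image of an integer polynomial in `ℚ[X]`. -/
def ratPoly (P : Polynomial ℤ) : Polynomial ℚ := P.map (Int.castRingHom ℚ)

/-- `k` is good for the sequence `P`: `P_{k-1}, P_k, P_{k+1}` are `ℚ`-linearly independent. -/
def Good (P : ℕ → Polynomial ℤ) (k : ℕ) : Prop :=
  LinearIndependent ℚ ![ratPoly (P (k-1)), ratPoly (P k), ratPoly (P (k+1))]

/-- `τ_k = log H_k / log H_{k-1}`. -/
def tauk (P : ℕ → Polynomial ℤ) (k : ℕ) : ℝ :=
  Real.log (polyHeight (P k)) / Real.log (polyHeight (P (k-1)))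

/-- `μ_k = -log |P_{k-1}(ξ)| / log H_k`. -/
def muk (ξ : ℝ) (P : ℕ → Polynomial ℤ) (k : ℕ) : ℝ :=
  - Real.log |Polynomial.aeval ξ (P (k-1))| / Real.log (polyHeight (P k))

/-- `v_k = -log |P_k(ξ)| / log H_k`. -/
def vk (ξ : ℝ) (P : ℕ → Polynomial ℤ) (k : ℕ) : ℝ :=
  - Real.log |Polynomial.aeval ξ (P k)| / Real.log (polyHeight (P k))

/-- The set of integers `m ≥ k+1` such that `P_{k-1}, …, P_{m-1}` all lie in the
two-dimensional space spanned by `P_{k-1}` and `P_k`; its greatest element is `ℓ(k)`. -/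
def ellSet (P : ℕ → Polynomial ℤ) (k : ℕ) : Set ℕ :=
  {m | k + 1 ≤ m ∧ ∀ j, k - 1 ≤ j → j ≤ m - 1 →
    ratPoly (P j) ∈ Submodule.span ℚ {ratPoly (P (k-1)), ratPoly (P k)}}

/-- The set `V_k = {P, T·P, …, T^{n-2}·P}` (as rational polynomials). -/
def Vset (n : ℕ) (A : Polynomial ℤ) : Set (Polynomial ℚ) :=
  {q | ∃ i ≤ n - 2, q = Polynomial.X ^ i * ratPoly A}

/-- The trajectory `L_P(q) = max(log H(P) - q/(2n-2), log |P(ξ)| + q)`. -/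
def LPtraj (n : ℕ) (ξ : ℝ) (Q : Polynomial ℤ) (q : ℝ) : ℝ :=
  max (Real.log (polyHeight Q) - q / (2*(n:ℝ)-2)) (Real.log |Polynomial.aeval ξ Q| + q)

/-- The `j`-th successive minimum function `L_j(q)`: the infimum over sets of `j`
linearly independent integer polynomials of degree at most `2n-2` of the maximum of
`L_P(q)` over the set. -/
def Lj (n : ℕ) (ξ : ℝ) (j : ℕ) (q : ℝ) : ℝ :=
  sInf {y : ℝ | ∃ S : Finset (Polynomial ℤ), S.card = j ∧
    (∀ Q ∈ S, Q.natDegree ≤ 2*n-2) ∧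
    LinearIndependent ℚ (fun Q : {x // x ∈ S} => ratPoly (Q : Polynomial ℤ)) ∧
    y = sSup ((fun Q => LPtraj n ξ Q q) '' (S : Set (Polynomial ℤ)))}

/-! ### Heights -/

lemma abs_coeff_le_polyHeight (P : ℤ[X]) (i : ℕ) : |(P.coeff i : ℝ)| ≤ polyHeight P := by
  by_cases h : i ∈ P.support
  · have : (P.coeff i).natAbs ≤ polyHeight P :=
      Finset.le_sup (f := fun i => (P.coeff i).natAbs) h
    rw [← Int.cast_abs, Int.abs_eq_natAbs]
    exact_mod_cast this
  · simp [Polynomial.notMem_support_iff.mp h]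

lemma polyHeight_le {P : ℤ[X]} {B : ℝ} (hB : 0 ≤ B) (h : ∀ i, |(P.coeff i : ℝ)| ≤ B) :
    (polyHeight P : ℝ) ≤ B := by
  rw [← Nat.le_floor_iff hB]
  refine Finset.sup_le fun i _ => ?_
  rw [Nat.le_floor_iff hB]
  have := h i
  rwa [← Int.cast_abs, Int.abs_eq_natAbs, Int.cast_natCast] at this

lemma polyHeight_neg (P : ℤ[X]) : polyHeight (-P) = polyHeight P := by
  simp [polyHeight]

lemma one_le_polyHeight {P : ℤ[X]} (hP : P ≠ 0) : (1 : ℝ) ≤ polyHeight P := by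
  refine le_trans ?_ (abs_coeff_le_polyHeight P P.natDegree)
  have : (1 : ℤ) ≤ |P.coeff P.natDegree| := Int.one_le_abs (by simpa using hP)
  exact_mod_cast this

lemma exists_abs_coeff_eq_polyHeight {P : ℤ[X]} (hP : P ≠ 0) :
    ∃ i, |(P.coeff i : ℝ)| = polyHeight P := by
  obtain ⟨i, -, hi⟩ := Finset.exists_mem_eq_sup P.support
    (Polynomial.support_nonempty.mpr hP) (fun i => (P.coeff i).natAbs)
  refine ⟨i, ?_⟩
  rw [← Int.cast_abs, Int.abs_eq_natAbs, Int.cast_natCast]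
  exact_mod_cast hi.symm

lemma finite_setOf_polyHeight_le (n H : ℕ) :
    {P : ℤ[X] | P.natDegree ≤ n ∧ polyHeight P ≤ H}.Finite := by
  refine Set.Finite.of_finite_image (f := fun P : ℤ[X] => fun i : Fin (n + 1) => P.coeff i)
    ((Set.finite_Icc (fun _ : Fin (n + 1) => -(H : ℤ)) (fun _ => (H : ℤ))).subset ?_) ?_
  · rintro _ ⟨P, ⟨-, hP⟩, rfl⟩
    have key : ∀ i : Fin (n + 1), |P.coeff i| ≤ (H : ℤ) := fun i => by
      have h := (abs_coeff_le_polyHeight P i).trans (Nat.cast_le.mpr hP)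
      exact_mod_cast h
    exact ⟨fun i => (abs_le.mp (key i)).1, fun i => (abs_le.mp (key i)).2⟩
  · intro P hP Q hQ hPQ
    ext i
    by_cases hi : i < n + 1
    · exact congrFun hPQ ⟨i, hi⟩
    · rw [Polynomial.coeff_eq_zero_of_natDegree_lt (by have := hP.1; omega),
        Polynomial.coeff_eq_zero_of_natDegree_lt (by have := hQ.1; omega)]

/-! ### Determinants of families of polynomials -/

/-- Integer polynomials of degree less than their number which are linearly independent have a
coefficient matrix of determinant at least one in absolute value, and replacing its first column by
the values at `ξ` does not change the determinant. -/
lemma one_le_of_linearIndependent {ι : Type*} [Fintype ι] {N : ℕ} (hN : 0 < N)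
    (hcard : Fintype.card ι = N) (Q : ι → ℤ[X]) (hdeg : ∀ i, (Q i).natDegree < N)
    (hli : LinearIndependent ℚ fun i => ratPoly (Q i)) (ξ : ℝ) (B : ι → ℝ) (ρ : ℝ)
    (hB : ∀ i j, |((Q i).coeff j : ℝ)| ≤ B i) (hρ : ∀ i, |aeval ξ (Q i)| ≤ ρ * B i) :
    1 ≤ (N.factorial : ℝ) * (ρ * ∏ i, B i) := by
  obtain ⟨m, rfl⟩ : ∃ m, N = m + 1 := ⟨N - 1, by omega⟩
  let e : Fin (m + 1) ≃ ι := (Fintype.equivFinOfCardEq hcard).symm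
  let M : Matrix (Fin (m + 1)) (Fin (m + 1)) ℤ := Matrix.of fun i j => (Q (e i)).coeff j
  have hM : M.det ≠ 0 := by
    intro h0
    have h0' : (M.map (Int.castRingHom ℚ)).det = 0 := by
      have := RingHom.map_det (Int.castRingHom ℚ) M
      rw [h0, map_zero] at this
      exact this.symm
    obtain ⟨v, hv, hv0⟩ := Matrix.exists_vecMul_eq_zero_iff.mpr h0'
    have hli' := (Fintype.linearIndependent_iff).mp (hli.comp e e.injective) v
    apply hv
    funext i
    refine hli' ?_ i
    ext j
    rw [Polynomial.finsetSum_coeff, Polynomial.coeff_zero]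
    by_cases hj : j < m + 1
    · have := congrFun hv0 ⟨j, hj⟩
      simpa [Matrix.vecMul, dotProduct, M, ratPoly] using this
    · refine Finset.sum_eq_zero fun i _ => ?_
      have : (Q (e i)).coeff j = 0 :=
        Polynomial.coeff_eq_zero_of_natDegree_lt (by have := hdeg (e i); omega)
      simp [ratPoly, this]
  let MR : Matrix (Fin (m + 1)) (Fin (m + 1)) ℝ := M.map (Int.castRingHom ℝ)
  have hMR : MR.det = (M.det : ℝ) := (RingHom.map_det (Int.castRingHom ℝ) M).symm
  have h1 : (1 : ℝ) ≤ |MR.det| := by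
    rw [hMR]
    exact_mod_cast Int.one_le_abs hM
  let M' := MR.updateCol 0 (fun i => aeval ξ (Q (e i)))
  have hM' : M'.det = MR.det := by
    have hsum := Matrix.det_updateCol_sum MR 0 (fun j => ξ ^ (j : ℕ))
    simp only [Fin.val_zero, pow_zero, one_smul] at hsum
    rw [← hsum]
    have hcol : (fun i => aeval ξ (Q (e i))) =
        fun k => ∑ i : Fin (m + 1), ξ ^ (i : ℕ) • MR k i := ?_
    · simp only [M', hcol]
    funext i
    rw [Polynomial.aeval_eq_sum_range' (hdeg (e i)), Finset.sum_range]
    refine Finset.sum_congr rfl fun j _ => ?_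
    simp [MR, M, mul_comm]
  have hBnn : ∀ i, 0 ≤ B i := fun i => (abs_nonneg _).trans (hB i 0)
  calc (1 : ℝ) ≤ |M'.det| := by rw [hM']; exact h1
    _ ≤ ∑ σ : Equiv.Perm (Fin (m + 1)), (ρ * ∏ i, B i) := by
        rw [Matrix.det_apply']
        refine (Finset.abs_sum_le_sum_abs _ _).trans (Finset.sum_le_sum fun σ _ => ?_)
        have hs : |((Equiv.Perm.sign σ : ℤ) : ℝ)| = 1 := by
          rcases Int.units_eq_one_or (Equiv.Perm.sign σ) with h | h <;> simp [h]
        rw [abs_mul, hs, one_mul, Finset.abs_prod, Fin.prod_univ_succ]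
        have hprod : ∏ i, B i = B (e (σ 0)) * ∏ j : Fin m, B (e (σ j.succ)) := by
          rw [← Fin.prod_univ_succ (fun j => B (e (σ j)))]
          exact (Equiv.prod_comp (σ.trans e) B).symm
        rw [hprod, ← mul_assoc]
        refine mul_le_mul ?_ ?_ (Finset.prod_nonneg fun _ _ => abs_nonneg _) ?_
        · simpa [M'] using hρ (e (σ 0))
        · refine Finset.prod_le_prod (fun _ _ => abs_nonneg _) fun j _ => ?_
          have hj : M' (σ j.succ) j.succ =
              ((Q (e (σ j.succ))).coeff (j.succ : Fin (m + 1)) : ℝ) := by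
            simp [M', MR, M]
          rw [hj]
          exact hB _ _
        · exact (abs_nonneg _).trans (hρ _)
    _ = _ := by
        simp [Finset.sum_const, Finset.card_univ, Fintype.card_perm]

lemma one_le_of_linearIndependent_shift {ι : Type*} [Fintype ι] {N : ℕ} (hN : 0 < N)
    (hcard : Fintype.card ι = N) (e : ι → ℕ) (R : ι → ℤ[X])
    (hdeg : ∀ i, e i + (R i).natDegree < N)
    (hli : LinearIndependent ℚ fun i => X ^ e i * ratPoly (R i)) (ξ : ℝ) (B : ι → ℝ) (ρ : ℝ)
    (hB : ∀ i, (polyHeight (R i) : ℝ) ≤ B i) (hρ : ∀ i, |aeval ξ (R i)| ≤ ρ * B i) :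
    1 ≤ (N.factorial : ℝ) * (1 + |ξ|) ^ N * (ρ * ∏ i, B i) := by
  have key := one_le_of_linearIndependent hN hcard (fun i => X ^ e i * R i)
    (fun i => (Polynomial.natDegree_mul_le).trans_lt
      ((Nat.add_le_add_right (Polynomial.natDegree_X_pow_le _) _).trans_lt (hdeg i)))
    (by simpa [ratPoly] using hli) ξ B ((1 + |ξ|) ^ N * ρ)
    (fun i j => by
      refine le_trans ?_ (hB i)
      rw [Polynomial.coeff_X_pow_mul']
      split_ifs
      · exact abs_coeff_le_polyHeight _ _
      · simp)
    (fun i => by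
      have h1 : |ξ| ^ e i ≤ (1 + |ξ|) ^ N :=
        (pow_le_pow_left₀ (abs_nonneg ξ) (by linarith) _).trans
          (pow_le_pow_right₀ (by linarith [abs_nonneg ξ]) (by have := hdeg i; omega))
      simp only [map_mul, map_pow, Polynomial.aeval_X, abs_mul, abs_pow, mul_assoc]
      exact mul_le_mul h1 (hρ i) (abs_nonneg _) (by positivity))
  calc (1 : ℝ) ≤ _ := key
    _ = _ := by ring

/-! ### Linear independence of shifts -/

/-- No nontrivial relation `α * A + β * B = 0` with `deg α < a` and `deg β < b`. -/
def NoRelation (A B : ℚ[X]) (a b : ℕ) : Prop :=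
  ∀ α β : ℚ[X], α.degree < a → β.degree < b → α * A + β * B = 0 → α = 0 ∧ β = 0

lemma NoRelation.linearIndependent {A B : ℚ[X]} {a b : ℕ} (h : NoRelation A B a b) :
    LinearIndependent ℚ
      (Sum.elim (fun i : Fin a => X ^ (i : ℕ) * A) (fun i : Fin b => X ^ (i : ℕ) * B)) := by
  rw [Fintype.linearIndependent_iff]
  intro g hg
  have hcoeff : ∀ (c : ℕ) (f : Fin c → ℚ), (∑ i : Fin c, C (f i) * X ^ (i : ℕ) = 0) →
      ∀ i, f i = 0 := by
    intro c f hf i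
    have := congrArg (fun p => p.coeff (i : ℕ)) hf
    simpa [Polynomial.finsetSum_coeff, Polynomial.coeff_C_mul, Polynomial.coeff_X_pow,
      Fin.val_inj] using this
  obtain ⟨h1, h2⟩ := h (∑ i : Fin a, C (g (Sum.inl i)) * X ^ (i : ℕ))
    (∑ i : Fin b, C (g (Sum.inr i)) * X ^ (i : ℕ)) (Polynomial.degree_sum_fin_lt _)
    (Polynomial.degree_sum_fin_lt _) (by
      rw [← hg, Fintype.sum_sum_type, Finset.sum_mul, Finset.sum_mul]
      simp [Polynomial.smul_eq_C_mul, mul_assoc])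
  rintro (i | i)
  · exact hcoeff a _ h1 i
  · exact hcoeff b _ h2 i

lemma exists_of_mem_span_shift {A B p : ℚ[X]} {a b : ℕ}
    (h : p ∈ Submodule.span ℚ (Set.range
      (Sum.elim (fun i : Fin a => X ^ (i : ℕ) * A) (fun i : Fin b => X ^ (i : ℕ) * B)))) :
    ∃ α β : ℚ[X], α.degree < a ∧ β.degree < b ∧ p = α * A + β * B := by
  obtain ⟨g, rfl⟩ := (Submodule.mem_span_range_iff_exists_fun ℚ).mp h
  refine ⟨∑ i : Fin a, C (g (Sum.inl i)) * X ^ (i : ℕ),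
    ∑ i : Fin b, C (g (Sum.inr i)) * X ^ (i : ℕ), Polynomial.degree_sum_fin_lt _,
    Polynomial.degree_sum_fin_lt _, ?_⟩
  rw [Fintype.sum_sum_type, Finset.sum_mul, Finset.sum_mul]
  simp [Polynomial.smul_eq_C_mul, mul_assoc]

/-- If all `X ^ j * R` with `j < m` are combinations of `A` and `B` with coefficients of degree
less than `m`, then `R` is a combination of `A` and `B` with constant coefficients. -/
lemma NoRelation.exists_shift_notMem {A B R : ℚ[X]} {m : ℕ} (hm : 0 < m)
    (h : NoRelation A B (m + 1) (m + 1)) (hR : R ∉ Submodule.span ℚ {A, B}) :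
    ∃ j < m, X ^ j * R ∉ Submodule.span ℚ (Set.range
      (Sum.elim (fun i : Fin m => X ^ (i : ℕ) * A) (fun i : Fin m => X ^ (i : ℕ) * B))) := by
  by_contra! hcon
  have hex : ∀ j, ∃ α β : ℚ[X], j < m → α.degree < m ∧ β.degree < m ∧
      X ^ j * R = α * A + β * B := by
    intro j
    by_cases hj : j < m
    · obtain ⟨α, β, h1⟩ := exists_of_mem_span_shift (hcon j hj)
      exact ⟨α, β, fun _ => h1⟩
    · exact ⟨0, 0, fun h => absurd h hj⟩
  choose α β hαβ using hex
  have hX : ∀ p : ℚ[X], p.degree < (m : WithBot ℕ) →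
      (X * p).degree < ((m + 1 : ℕ) : WithBot ℕ) := by
    intro p hp
    rw [Polynomial.degree_mul, Polynomial.degree_X, add_comm]
    push_cast
    exact WithBot.add_lt_add_right (by simp) hp
  have hpow : ∀ j < m, α j = X ^ j * α 0 ∧ β j = X ^ j * β 0 := by
    intro j
    induction j with
    | zero => simp
    | succ j ih =>
      intro hj
      obtain ⟨i1, i2⟩ := ih (by omega)
      obtain ⟨a1, b1, e1⟩ := hαβ j (by omega)
      obtain ⟨a2, b2, e2⟩ := hαβ (j + 1) hj
      have hlt : ((m : ℕ) : WithBot ℕ) < ((m + 1 : ℕ) : WithBot ℕ) := by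
        exact_mod_cast Nat.lt_succ_self m
      obtain ⟨r1, r2⟩ := h (X * α j - α (j + 1)) (X * β j - β (j + 1))
        ((Polynomial.degree_sub_le _ _).trans_lt (max_lt (hX _ a1) (a2.trans hlt)))
        ((Polynomial.degree_sub_le _ _).trans_lt (max_lt (hX _ b1) (b2.trans hlt)))
        (by linear_combination e2 - X * e1)
      rw [sub_eq_zero] at r1 r2
      exact ⟨by rw [← r1, i1, pow_succ']; ring, by rw [← r2, i2, pow_succ']; ring⟩
  have hconst : ∀ p : ℚ[X], (X ^ (m - 1) * p).degree < (m : WithBot ℕ) → ∃ c, p = C c := by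
    intro p hp
    by_cases hp0 : p = 0
    · exact ⟨0, by simp [hp0]⟩
    refine ⟨p.coeff 0, Polynomial.eq_C_of_natDegree_eq_zero ?_⟩
    rw [Polynomial.degree_mul, Polynomial.degree_X_pow, Polynomial.degree_eq_natDegree hp0] at hp
    have : m - 1 + p.natDegree < m := by exact_mod_cast hp
    omega
  obtain ⟨a1, b1, -⟩ := hαβ (m - 1) (by omega)
  obtain ⟨p1, p2⟩ := hpow (m - 1) (by omega)
  obtain ⟨c, hc⟩ := hconst (α 0) (by rwa [← p1])
  obtain ⟨d, hd⟩ := hconst (β 0) (by rwa [← p2])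
  obtain ⟨-, -, e0⟩ := hαβ 0 hm
  refine hR (Submodule.mem_span_pair.mpr ⟨c, d, ?_⟩)
  rw [Polynomial.smul_eq_C_mul, Polynomial.smul_eq_C_mul, ← hc, ← hd, ← e0]
  simp

lemma noRelation_of_irreducible {A P : ℤ[X]} (hA : Irreducible A) (hdeg : A.natDegree ≠ 0)
    (hAP : ¬ A ∣ P) (a : ℕ) :
    NoRelation (ratPoly A) (ratPoly P) a A.natDegree := by
  have hprim : A.IsPrimitive := hA.isPrimitive hdeg
  have hinj : Function.Injective (Int.castRingHom ℚ) := Int.cast_injective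
  have hirr : Irreducible (ratPoly A) :=
    (Polynomial.IsPrimitive.Int.irreducible_iff_irreducible_map_cast hprim).mp hA
  have hdegA : (ratPoly A).degree = A.natDegree := by
    rw [ratPoly, Polynomial.degree_map_eq_of_injective hinj,
      Polynomial.degree_eq_natDegree hA.ne_zero]
  intro α β _ hβ hrel
  have hdvd : ratPoly A ∣ β * ratPoly P := ⟨-α, by linear_combination hrel⟩
  have hβ0 : β = 0 := by
    rcases hirr.prime.dvd_or_dvd hdvd with h | h
    · by_contra hne
      exact absurd (Polynomial.degree_le_of_dvd h hne) (not_le.mpr (by rwa [hdegA]))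
    · exact absurd
        ((Polynomial.IsPrimitive.Int.dvd_iff_map_cast_dvd_map_cast A P hprim).mpr h) hAP
  subst hβ0
  refine ⟨?_, rfl⟩
  rw [zero_mul, add_zero] at hrel
  exact (mul_eq_zero.mp hrel).resolve_right hirr.ne_zero

/-! ### The Mahler measure of an integer polynomial -/

/-- The Mahler measure of an integer polynomial. -/
def intMahler (A : ℤ[X]) : ℝ := (A.map (Int.castRingHom ℂ)).mahlerMeasure

lemma intMahler_mul (A B : ℤ[X]) : intMahler (A * B) = intMahler A * intMahler B := by
  simp [intMahler, Polynomial.mahlerMeasure_mul]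

lemma one_le_intMahler {A : ℤ[X]} (hA : A ≠ 0) : 1 ≤ intMahler A :=
  Polynomial.one_le_mahlerMeasure_of_ne_zero hA

lemma intMahler_le {n : ℕ} {A : ℤ[X]} (hA : A.natDegree ≤ n) :
    intMahler A ≤ (n + 1) * polyHeight A := by
  refine (Polynomial.mahlerMeasure_le_sum_norm_coeff _).trans ?_
  rw [Polynomial.sum_over_range' _ (by simp) (n + 1)
    (Nat.lt_succ_of_le ((Polynomial.natDegree_map_le).trans hA))]
  calc _ ≤ ∑ _i ∈ Finset.range (n + 1), (polyHeight A : ℝ) := by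
        refine Finset.sum_le_sum fun i _ => ?_
        simpa using abs_coeff_le_polyHeight A i
    _ = _ := by simp

lemma polyHeight_le_intMahler {n : ℕ} {A : ℤ[X]} (hA : A.natDegree ≤ n) :
    (polyHeight A : ℝ) ≤ 2 ^ n * intMahler A := by
  have h0 : 0 ≤ intMahler A := Polynomial.mahlerMeasure_nonneg _
  refine polyHeight_le (by positivity) fun i => ?_
  have h := Polynomial.norm_coeff_le_choose_mul_mahlerMeasure i (A.map (Int.castRingHom ℂ))
  rw [Polynomial.coeff_map, eq_intCast, Complex.norm_intCast] at h
  refine h.trans (mul_le_mul_of_nonneg_right ?_ h0)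
  have hle : (A.map (Int.castRingHom ℂ)).natDegree ≤ n := (Polynomial.natDegree_map_le).trans hA
  exact_mod_cast (Nat.choose_le_two_pow _ i).trans (Nat.pow_le_pow_right (by norm_num) hle)

/-! ### Best approximations -/

namespace IsBestApproxSeq

variable {n : ℕ} {ξ : ℝ} {P : ℕ → ℤ[X]}

lemma height_lt_of_lt (hP : IsBestApproxSeq n ξ P) {j k : ℕ} (hj : 1 ≤ j) (hjk : j < k) :
    polyHeight (P j) < polyHeight (P k) := by
  induction k, hjk using Nat.le_induction with
  | base => exact hP.height_lt j hj
  | succ m hm ih => exact ih.trans (hP.height_lt m (by omega))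

lemma height_le_of_le (hP : IsBestApproxSeq n ξ P) {j k : ℕ} (hj : 1 ≤ j) (hjk : j ≤ k) :
    polyHeight (P j) ≤ polyHeight (P k) := by
  rcases hjk.eq_or_lt with rfl | h
  · rfl
  · exact (hP.height_lt_of_lt hj h).le

lemma eval_le_of_le (hP : IsBestApproxSeq n ξ P) {j k : ℕ} (hj : 1 ≤ j) (hjk : j ≤ k) :
    |aeval ξ (P k)| ≤ |aeval ξ (P j)| :=
  hP.isMin k (hj.trans hjk) _ (hP.ne_zero j hj) (hP.deg_le j hj) (hP.height_le_of_le hj hjk)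

lemma eval_pos (hP : IsBestApproxSeq n ξ P) {k : ℕ} (hk : 1 ≤ k) : 0 < |aeval ξ (P k)| :=
  (abs_nonneg _).trans_lt (hP.eval_lt k hk)

lemma le_height (hP : IsBestApproxSeq n ξ P) {k : ℕ} (hk : 1 ≤ k) : k ≤ polyHeight (P k) := by
  induction k, hk using Nat.le_induction with
  | base => exact_mod_cast one_le_polyHeight (hP.ne_zero 1 le_rfl)
  | succ m hm ih => exact ih.trans_lt (hP.height_lt m hm)

lemma tendsto_height (hP : IsBestApproxSeq n ξ P) :
    Tendsto (fun k => (polyHeight (P k) : ℝ)) atTop atTop := by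
  refine tendsto_atTop_mono' _ ?_ tendsto_natCast_atTop_atTop
  filter_upwards [eventually_ge_atTop 1] with k hk
  exact_mod_cast hP.le_height hk

lemma le_eval_of_height_lt (hP : IsBestApproxSeq n ξ P) {k : ℕ} (hk : 1 ≤ k) {Q : ℤ[X]}
    (hQ : Q ≠ 0) (hdeg : Q.natDegree ≤ n) (hH : polyHeight Q < polyHeight (P (k + 1))) :
    |aeval ξ (P k)| ≤ |aeval ξ Q| := by
  let S : Set ℤ[X] := {R | (R.natDegree ≤ n ∧ polyHeight R ≤ polyHeight Q) ∧ R ≠ 0}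
  have hS : S.Finite := (finite_setOf_polyHeight_le n (polyHeight Q)).subset fun R hR => hR.1
  obtain ⟨R, hRS, hR⟩ := Set.exists_min_image S (fun R => |aeval ξ R|) hS ⟨Q, ⟨hdeg, le_rfl⟩, hQ⟩
  obtain ⟨j, hj, hRj⟩ := hP.complete R hRS.2 hRS.1.1
    fun T hT hTdeg hTH => hR T ⟨⟨hTdeg, hTH.trans hRS.1.2⟩, hT⟩
  have hHj : polyHeight R = polyHeight (P j) := by
    rcases hRj with h | h <;> simp [h, polyHeight_neg]
  have hej : |aeval ξ R| = |aeval ξ (P j)| := by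
    rcases hRj with h | h <;> simp [h]
  have hjk : j ≤ k := by
    by_contra hcon
    have h1 := hP.height_le_of_le (j := k + 1) (k := j) (by omega) (by omega)
    have h2 := hRS.1.2
    omega
  calc |aeval ξ (P k)| ≤ |aeval ξ (P j)| := hP.eval_le_of_le hj hjk
    _ = |aeval ξ R| := hej.symm
    _ ≤ |aeval ξ Q| := hR Q ⟨⟨hdeg, le_rfl⟩, hQ⟩

end IsBestApproxSeq

/-! ### Consequences of a lower bound for the uniform exponent -/

lemma mem_uniformExpSet_of_lt {n : ℕ} {ξ w : ℝ} (hw : (w : EReal) < wHat n ξ) :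
    w ∈ uniformExpSet n ξ := by
  obtain ⟨_, ⟨v, hv, rfl⟩, hwv⟩ := lt_sSup_iff.mp hw
  have hwv : w < v := EReal.coe_lt_coe_iff.mp hwv
  filter_upwards [hv, eventually_ge_atTop 1] with X hX hX1
  obtain ⟨Q, h1, h2, h3, h4⟩ := hX
  exact ⟨Q, h1, h2, h3, h4.trans_le (Real.rpow_le_rpow_of_exponent_le hX1 (by linarith))⟩

lemma IsBestApproxSeq.eventually_eval_lt {n : ℕ} {ξ : ℝ} {P : ℕ → ℤ[X]}
    (hP : IsBestApproxSeq n ξ P) {w : ℝ} (hw : w ∈ uniformExpSet n ξ) :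
    ∀ᶠ k in atTop, |aeval ξ (P k)| < ((polyHeight (P (k + 1)) : ℝ) / 2) ^ (-w) := by
  have ht : Tendsto (fun k => (polyHeight (P (k + 1)) : ℝ) / 2) atTop atTop :=
    ((tendsto_add_atTop_iff_nat 1).mpr hP.tendsto_height).atTop_div_const (by norm_num)
  filter_upwards [ht.eventually hw, eventually_ge_atTop 1] with k hk hk1
  obtain ⟨Q, h1, h2, h3, h4⟩ := hk
  have hQ : Q ≠ 0 := by
    rintro rfl
    simp at h3
  refine (hP.le_eval_of_height_lt hk1 hQ h1 ?_).trans_lt h4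
  have h5 := one_le_polyHeight (hP.ne_zero (k + 1) (by omega))
  have : (polyHeight Q : ℝ) < polyHeight (P (k + 1)) := by linarith
  exact_mod_cast this

lemma eventually_const_mul_rpow_neg_lt {s : ℝ} (hs : 0 < s) (K : ℝ) {ε : ℝ} (hε : 0 < ε) :
    ∀ᶠ X : ℝ in atTop, K * X ^ (-s) < ε := by
  have := (tendsto_rpow_neg_atTop hs).const_mul K
  rw [mul_zero] at this
  exact this.eventually (gt_mem_nhds hε)

/-- Irreducible polynomials of degree less than `n` cannot be too small at `ξ`. -/
lemma IsBestApproxSeq.exists_le_eval_irreducible {n : ℕ} (hn : 2 ≤ n) {ξ : ℝ} {P : ℕ → ℤ[X]}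
    (hP : IsBestApproxSeq n ξ P) {w : ℝ} (hw : w ∈ uniformExpSet n ξ)
    (hnw : 2 * (n : ℝ) - 2 < w) :
    ∃ c : ℝ, 0 < c ∧ c ≤ 1 ∧ ∀ A : ℤ[X], Irreducible A → A.natDegree ≠ 0 → A.natDegree < n →
      c ≤ |aeval ξ A| * intMahler A ^ (2 * n - 2) := by
  set K : ℝ := ((2 * n).factorial : ℝ) * (1 + |ξ|) ^ (2 * n) with hK
  have hKpos : 0 < K := by positivity
  set κ : ℝ := 2 ^ n * (2 * (n + 1)) with hκ
  have hκpos : 0 < κ := by positivity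
  obtain ⟨X₀, hX₀⟩ := ((hw.and (eventually_const_mul_rpow_neg_lt (sub_pos.mpr hnw) (K * κ ^ n)
    one_pos)).and (eventually_ge_atTop 1)).exists_forall_of_atTop
  obtain ⟨k, hk, hk1⟩ := ((hP.tendsto_height.eventually_ge_atTop (κ * X₀)).and
    (eventually_ge_atTop 1)).exists
  refine ⟨min (min (K * κ ^ n)⁻¹ |aeval ξ (P k)|) 1, ?_, min_le_right _ _, ?_⟩
  · exact lt_min (lt_min (by positivity) (hP.eval_pos hk1)) one_pos
  intro A hA hd hdn
  have hM1 : 1 ≤ intMahler A := one_le_intMahler hA.ne_zero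
  set M := intMahler A with hM
  have hMpow : 1 ≤ M ^ (2 * n - 2) := one_le_pow₀ hM1
  set Y : ℝ := M / (2 * (n + 1)) with hY
  have hMY : M = 2 * (n + 1) * Y := by rw [hY]; field_simp
  have hHA : (polyHeight A : ℝ) ≤ κ * Y := by
    refine (polyHeight_le_intMahler hdn.le).trans_eq ?_
    rw [← hM, hMY, hκ]; ring
  rcases lt_or_ge Y X₀ with hlt | hge
  · have h1 : |aeval ξ (P k)| ≤ |aeval ξ A| := by
      refine hP.isMin k hk1 A hA.ne_zero hdn.le ?_
      have : (polyHeight A : ℝ) ≤ polyHeight (P k) :=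
        hHA.trans ((mul_le_mul_of_nonneg_left hlt.le hκpos.le).trans hk)
      exact_mod_cast this
    calc _ ≤ |aeval ξ (P k)| := (min_le_left _ _).trans (min_le_right _ _)
      _ ≤ |aeval ξ A| := h1
      _ ≤ _ := le_mul_of_one_le_right (abs_nonneg _) hMpow
  · obtain ⟨⟨⟨Q, hQdeg, hQH, hQ0, hQlt⟩, hsmall⟩, hY1⟩ := hX₀ Y hge
    have hYpos : 0 < Y := by linarith
    have hQne : Q ≠ 0 := by
      rintro rfl
      simp at hQ0
    have hAQ : ¬ A ∣ Q := by
      rintro ⟨T, rfl⟩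
      have hT : T ≠ 0 := right_ne_zero_of_mul hQne
      have h1 := intMahler_le hQdeg
      rw [intMahler_mul] at h1
      have h2 := one_le_intMahler hT
      have h3 : M ≤ M * intMahler T := le_mul_of_one_le_right (by linarith) h2
      have h4 : ((n : ℝ) + 1) * polyHeight (A * T) ≤ (n + 1) * Y :=
        mul_le_mul_of_nonneg_left hQH (by positivity)
      have h5 : 0 < ((n : ℝ) + 1) * Y := by positivity
      linarith
    have hli := (noRelation_of_irreducible hA hd hAQ n).linearIndependent
    set m : ℝ := max |aeval ξ A| (Y ^ (-w)) with hm
    have hm0 : 0 < m := lt_max_of_lt_right (Real.rpow_pos_of_pos hYpos _)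
    have hκ1 : 1 ≤ κ := by
      have : (1 : ℝ) ≤ 2 ^ n := one_le_pow₀ (by norm_num)
      have h2 : (0 : ℝ) ≤ n := Nat.cast_nonneg n
      rw [hκ]; nlinarith
    have hdet := one_le_of_linearIndependent_shift (N := n + A.natDegree) (by omega)
      (by simp) (Sum.elim (fun i : Fin n => (i : ℕ)) (fun i : Fin A.natDegree => (i : ℕ)))
      (Sum.elim (fun _ => A) (fun _ => Q))
      (by rintro (i | i) <;> simp; omega)
      (by
        convert hli using 1
        funext i
        rcases i with i | i <;> simp)
      ξ (Sum.elim (fun _ => κ * Y) (fun _ => Y)) (m / Y)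
      (by
        rintro (i | i)
        · exact hHA
        · exact hQH)
      (by
        rintro (i | i)
        · have : m / Y * (κ * Y) = m * κ := by field_simp
          simp only [Sum.elim_inl, this]
          exact (le_max_left _ _).trans (le_mul_of_one_le_right hm0.le hκ1)
        · have : m / Y * Y = m := by field_simp
          simp only [Sum.elim_inr, this]
          exact hQlt.le.trans (le_max_right _ _))
    rw [Fintype.prod_sum_type] at hdet
    simp only [Sum.elim_inl, Sum.elim_inr, Finset.prod_const, Finset.card_univ,
      Fintype.card_fin] at hdet
    have hKle : (((n + A.natDegree).factorial : ℝ)) * (1 + |ξ|) ^ (n + A.natDegree) ≤ K := by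
      refine mul_le_mul ?_ (pow_le_pow_right₀ (by linarith [abs_nonneg ξ]) (by omega))
        (by positivity) (by positivity)
      exact_mod_cast Nat.factorial_le (by omega)
    have hpow : (κ * Y) ^ n * Y ^ A.natDegree ≤ κ ^ n * Y ^ (2 * n - 2) * Y := by
      rw [mul_pow, mul_assoc, mul_assoc, ← pow_add, ← pow_succ]
      exact mul_le_mul_of_nonneg_left (pow_le_pow_right₀ hY1 (by omega)) (by positivity)
    have hmain : 1 ≤ K * κ ^ n * Y ^ (2 * n - 2) * m := by
      calc (1 : ℝ) ≤ _ := hdet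
        _ ≤ K * (m / Y * (κ ^ n * Y ^ (2 * n - 2) * Y)) := by gcongr
        _ = _ := by field_simp
    have hsec : K * κ ^ n * Y ^ (2 * n - 2) * Y ^ (-w) < 1 := by
      convert hsmall using 1
      rw [mul_assoc, ← Real.rpow_natCast Y, ← Real.rpow_add hYpos]
      congr 2
      push_cast [Nat.cast_sub (show 2 ≤ 2 * n by omega)]
      ring
    have hfirst : 1 ≤ K * κ ^ n * Y ^ (2 * n - 2) * |aeval ξ A| := by
      rcases le_total |aeval ξ A| (Y ^ (-w)) with h | h
      · rw [hm, max_eq_right h] at hmain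
        linarith
      · rwa [hm, max_eq_left h] at hmain
    have hYM : Y ≤ M := by
      rw [hMY]
      have : (0 : ℝ) ≤ n := Nat.cast_nonneg n
      nlinarith
    calc _ ≤ (K * κ ^ n)⁻¹ := (min_le_left _ _).trans (min_le_left _ _)
      _ ≤ Y ^ (2 * n - 2) * |aeval ξ A| := by
          rw [inv_le_iff_one_le_mul₀' (by positivity)]
          linarith
      _ ≤ M ^ (2 * n - 2) * |aeval ξ A| := by gcongr
      _ = _ := mul_comm _ _

lemma IsBestApproxSeq.exists_pow_le_eval {n : ℕ} (hn : 2 ≤ n) {ξ : ℝ} {P : ℕ → ℤ[X]}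
    (hP : IsBestApproxSeq n ξ P) {w : ℝ} (hw : w ∈ uniformExpSet n ξ)
    (hnw : 2 * (n : ℝ) - 2 < w) :
    ∃ c : ℝ, 0 < c ∧ c ≤ 1 ∧ ∀ A : ℤ[X], A ≠ 0 →
      (∀ B : ℤ[X], Irreducible B → B ∣ A → B.natDegree < n) →
      c ^ A.natDegree ≤ |aeval ξ A| * intMahler A ^ (2 * n - 2) := by
  obtain ⟨c, hc0, hc1, hc⟩ := hP.exists_le_eval_irreducible hn hw hnw
  have hconst : ∀ A : ℤ[X], A ≠ 0 → A.natDegree = 0 →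
      1 ≤ |aeval ξ A| * intMahler A ^ (2 * n - 2) := by
    intro A hA hd
    refine one_le_mul_of_one_le_of_one_le ?_ (one_le_pow₀ (one_le_intMahler hA))
    obtain ⟨a, rfl⟩ : ∃ a, A = C a := ⟨_, Polynomial.eq_C_of_natDegree_eq_zero hd⟩
    have ha : a ≠ 0 := by simpa using hA
    simpa using (by exact_mod_cast Int.one_le_abs ha : (1 : ℝ) ≤ |(a : ℝ)|)
  refine ⟨c, hc0, hc1, fun A => ?_⟩
  induction A using WfDvdMonoid.induction_on_irreducible with
  | zero => exact fun h => absurd rfl h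
  | unit u hu =>
    intro hu0 _
    have hd := Polynomial.natDegree_eq_zero_of_isUnit hu
    rw [hd, pow_zero]
    exact hconst u hu0 hd
  | mul A B hA hB ih =>
    intro _ hfac
    have h1 := ih hA fun T hT hTA => hfac T hT (hTA.mul_left B)
    have h2 : c ^ B.natDegree ≤ |aeval ξ B| * intMahler B ^ (2 * n - 2) := by
      by_cases hd : B.natDegree = 0
      · rw [hd, pow_zero]
        exact hconst B hB.ne_zero hd
      · exact (pow_le_of_le_one hc0.le hc1 hd).trans
          (hc B hB hd (hfac B hB (dvd_mul_right B A)))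
    rw [Polynomial.natDegree_mul hB.ne_zero hA, pow_add, map_mul, abs_mul, intMahler_mul, mul_pow]
    calc _ ≤ (|aeval ξ B| * intMahler B ^ (2 * n - 2)) *
          (|aeval ξ A| * intMahler A ^ (2 * n - 2)) :=
          mul_le_mul h2 h1 (by positivity) ((by positivity : 0 ≤ c ^ B.natDegree).trans h2)
      _ = _ := by ring

lemma IsBestApproxSeq.eventually_irreducible {n : ℕ} (hn : 2 ≤ n) {ξ : ℝ} {P : ℕ → ℤ[X]}
    (hP : IsBestApproxSeq n ξ P) {w : ℝ} (hw : w ∈ uniformExpSet n ξ)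
    (hnw : 2 * (n : ℝ) - 2 < w) :
    ∀ᶠ k in atTop, Irreducible (P k) ∧ (P k).natDegree = n := by
  obtain ⟨c, hc0, hc1, hc⟩ := hP.exists_pow_le_eval hn hw hnw
  have ht : Tendsto (fun k => (polyHeight (P k) : ℝ) / 2) atTop atTop :=
    hP.tendsto_height.atTop_div_const (by norm_num)
  filter_upwards [eventually_ge_atTop 1, hP.eventually_eval_lt hw,
    ht.eventually (eventually_const_mul_rpow_neg_lt (sub_pos.mpr hnw)
      ((2 * ((n : ℝ) + 1)) ^ (2 * n - 2)) (pow_pos hc0 n))] with k hk1 hlt hsmall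
  have hne := hP.ne_zero k hk1
  have hH := one_le_polyHeight hne
  set Y : ℝ := (polyHeight (P k) : ℝ) / 2 with hY
  have hYpos : 0 < Y := by positivity
  have hex : ∃ B : ℤ[X], Irreducible B ∧ B ∣ P k ∧ n ≤ B.natDegree := by
    by_contra! hcon
    have h1 := hc (P k) hne hcon
    have h2 : c ^ n ≤ c ^ (P k).natDegree := pow_le_pow_of_le_one hc0.le hc1 (hP.deg_le k hk1)
    have h3 : |aeval ξ (P k)| ≤ Y ^ (-w) := by
      refine hlt.le.trans (Real.rpow_le_rpow_of_nonpos hYpos ?_ ?_)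
      · have := (Nat.cast_le (α := ℝ)).mpr (hP.height_lt k hk1).le
        rw [hY]; linarith
      · have : (2 : ℝ) ≤ n := by exact_mod_cast hn
        linarith
    have h4 : intMahler (P k) ≤ 2 * ((n : ℝ) + 1) * Y := by
      refine (intMahler_le (hP.deg_le k hk1)).trans_eq ?_
      rw [hY]; ring
    have h5 : |aeval ξ (P k)| * intMahler (P k) ^ (2 * n - 2) ≤
        Y ^ (-w) * (2 * ((n : ℝ) + 1) * Y) ^ (2 * n - 2) := by
      have := one_le_intMahler hne
      gcongr
    have h6 : Y ^ (-w) * (2 * ((n : ℝ) + 1) * Y) ^ (2 * n - 2) =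
        (2 * ((n : ℝ) + 1)) ^ (2 * n - 2) * Y ^ (-(w - (2 * (n : ℝ) - 2))) := by
      rw [mul_pow, mul_left_comm, ← Real.rpow_natCast Y, ← Real.rpow_add hYpos]
      congr 2
      push_cast [Nat.cast_sub (show 2 ≤ 2 * n by omega)]
      ring
    linarith
  obtain ⟨B, hB, ⟨T, hT⟩, hBn⟩ := hex
  have hT0 : T ≠ 0 := by
    rintro rfl
    exact hne (by simpa using hT)
  have hdeg : B.natDegree + T.natDegree = (P k).natDegree := by
    rw [hT, Polynomial.natDegree_mul hB.ne_zero hT0]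
  have hle := hP.deg_le k hk1
  obtain ⟨t, rfl⟩ : ∃ t, T = C t := ⟨_, Polynomial.eq_C_of_natDegree_eq_zero (by omega)⟩
  have ht0 : t ≠ 0 := by simpa using hT0
  have ht1 : (1 : ℝ) ≤ |(t : ℝ)| := by exact_mod_cast Int.one_le_abs ht0
  have hHB : polyHeight B ≤ polyHeight (P k) := by
    have : (polyHeight B : ℝ) ≤ polyHeight (P k) := by
      refine polyHeight_le (by positivity) fun i => ?_
      refine le_trans ?_ (abs_coeff_le_polyHeight (P k) i)
      rw [hT, Polynomial.coeff_mul_C, Int.cast_mul, abs_mul]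
      exact le_mul_of_one_le_right (abs_nonneg _) ht1
    exact_mod_cast this
  have hmin := hP.isMin k hk1 B hB.ne_zero (by omega) hHB
  have hev : |aeval ξ (P k)| = |aeval ξ B| * |(t : ℝ)| := by
    rw [hT, map_mul, abs_mul]
    simp
  have hpos := hP.eval_pos hk1
  have hBpos : 0 < |aeval ξ B| := hpos.trans_le hmin
  have ht2 : |(t : ℝ)| ≤ 1 := by
    rw [hev] at hmin
    by_contra hcon
    nlinarith
  have htu : IsUnit t := by
    rw [Int.isUnit_iff_abs_eq]
    exact_mod_cast le_antisymm ht2 ht1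
  refine ⟨?_, by omega⟩
  rw [hT]
  exact (irreducible_mul_isUnit (Polynomial.isUnit_C.mpr htu)).mpr hB


lemma aeval_C_mul_int (ξ : ℝ) (a : ℤ) (A : ℤ[X]) : aeval ξ (C a * A) = a * aeval ξ A := by
  simp

/-! ### Pairs of consecutive best approximations -/

namespace IsBestApproxSeq

variable {n : ℕ} {ξ : ℝ} {P : ℕ → ℤ[X]}

lemma noRelation (hP : IsBestApproxSeq n ξ P) (hn : n ≠ 0) {k : ℕ} (hk : 1 ≤ k)
    (hirr : Irreducible (P k)) (hdeg : (P k).natDegree = n) (hirr' : Irreducible (P (k + 1))) :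
    NoRelation (ratPoly (P k)) (ratPoly (P (k + 1))) n n := by
  have hndvd : ¬ P k ∣ P (k + 1) := by
    intro hdvd
    obtain ⟨u, hu⟩ := hirr.associated_of_dvd hirr' hdvd
    obtain ⟨t, ht, htu⟩ := Polynomial.isUnit_iff.mp u.isUnit
    have hlt := hP.height_lt k hk
    rw [← hu, ← htu] at hlt
    rcases Int.isUnit_iff.mp ht with rfl | rfl
    · simp at hlt
    · simp [polyHeight_neg] at hlt
  have := noRelation_of_irreducible hirr (by rwa [hdeg]) hndvd n
  rwa [hdeg] at this

lemma abs_eval_le_ratio (hP : IsBestApproxSeq n ξ P) {k j : ℕ} (hk : 1 ≤ k) (hkj : k ≤ j) :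
    |aeval ξ (P j)| ≤ |aeval ξ (P k)| / polyHeight (P k) * polyHeight (P j) := by
  have h1 := one_le_polyHeight (hP.ne_zero k hk)
  have h2 : (polyHeight (P k) : ℝ) ≤ polyHeight (P j) := by
    exact_mod_cast hP.height_le_of_le hk hkj
  refine (hP.eval_le_of_le hk hkj).trans ?_
  rw [div_mul_eq_mul_div, le_div_iff₀ (by linarith)]
  exact mul_le_mul_of_nonneg_left h2 (abs_nonneg _)

/-- The resultant of two consecutive coprime best approximations is at least one. -/
lemma one_le_resultant_bound (hP : IsBestApproxSeq n ξ P) (hn : n ≠ 0) {k : ℕ} (hk : 1 ≤ k)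
    (hrel : NoRelation (ratPoly (P k)) (ratPoly (P (k + 1))) n n) :
    1 ≤ ((2 * n).factorial : ℝ) * (1 + |ξ|) ^ (2 * n) * ((polyHeight (P k) : ℝ) ^ (n - 1) *
      (polyHeight (P (k + 1)) : ℝ) ^ n * |aeval ξ (P k)|) := by
  have hdet := one_le_of_linearIndependent_shift (N := 2 * n) (by omega)
    (by simp; omega) (Sum.elim (fun i : Fin n => (i : ℕ)) (fun i : Fin n => (i : ℕ)))
    (Sum.elim (fun _ => P k) (fun _ => P (k + 1)))
    (by
      have h1 := hP.deg_le k hk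
      have h2 := hP.deg_le (k + 1) (by omega)
      rintro (i | i)
      · simp only [Sum.elim_inl]
        omega
      · simp only [Sum.elim_inr]
        omega)
    (by
      convert hrel.linearIndependent using 1
      funext i
      rcases i with i | i <;> simp)
    ξ (Sum.elim (fun _ => (polyHeight (P k) : ℝ)) (fun _ => (polyHeight (P (k + 1)) : ℝ)))
    (|aeval ξ (P k)| / polyHeight (P k))
    (by rintro (i | i) <;> simp)
    (by
      rintro (i | i)
      · exact hP.abs_eval_le_ratio hk le_rfl
      · exact hP.abs_eval_le_ratio hk (Nat.le_succ k))
  refine hdet.trans_eq ?_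
  rw [Fintype.prod_sum_type]
  simp only [Sum.elim_inl, Sum.elim_inr, Finset.prod_const, Finset.card_univ, Fintype.card_fin]
  have hH := one_le_polyHeight (hP.ne_zero k hk)
  obtain ⟨m, rfl⟩ := Nat.exists_eq_succ_of_ne_zero hn
  simp only [Nat.succ_eq_add_one, Nat.add_sub_cancel]
  field_simp
  ring

/-- The determinant bound for the shifts of two consecutive best approximations and one shift of a
later best approximation outside of their span. -/
lemma one_le_determinant_bound (hP : IsBestApproxSeq n ξ P) (hn : 2 ≤ n) {k l : ℕ} (hk : 1 ≤ k)
    (hkl : k ≤ l) (hrel : NoRelation (ratPoly (P k)) (ratPoly (P (k + 1))) n n)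
    (hl : ratPoly (P l) ∉ Submodule.span ℚ {ratPoly (P k), ratPoly (P (k + 1))}) :
    1 ≤ ((2 * n).factorial : ℝ) * (1 + |ξ|) ^ (2 * n) * ((polyHeight (P k) : ℝ) ^ (n - 2) *
      (polyHeight (P (k + 1)) : ℝ) ^ (n - 1) * polyHeight (P l) * |aeval ξ (P k)|) := by
  obtain ⟨m, rfl⟩ : ∃ m, n = m + 2 := ⟨n - 2, by omega⟩
  obtain ⟨j, hj, hnot⟩ := NoRelation.exists_shift_notMem (m := m + 1) (by omega) hrel hl
  have hrel' : NoRelation (ratPoly (P k)) (ratPoly (P (k + 1))) (m + 1) (m + 1) :=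
    fun α β hα hβ h => hrel α β (hα.trans (by exact_mod_cast Nat.lt_succ_self _))
      (hβ.trans (by exact_mod_cast Nat.lt_succ_self _)) h
  have hli := hrel'.linearIndependent.option hnot
  have hH := one_le_polyHeight (hP.ne_zero k hk)
  have hdet := one_le_of_linearIndependent_shift (N := 2 * m + 3) (by omega)
    (by simp; omega)
    (fun o : Option (Fin (m + 1) ⊕ Fin (m + 1)) =>
      o.elim j (Sum.elim (fun i => (i : ℕ)) (fun i => (i : ℕ))))
    (fun o => o.elim (P l) (Sum.elim (fun _ => P k) (fun _ => P (k + 1))))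
    (by
      have h1 := hP.deg_le k hk
      have h2 := hP.deg_le (k + 1) (by omega)
      have h3 := hP.deg_le l (by omega)
      rintro (_ | i | i)
      · simp only [Option.elim_none]
        omega
      · simp only [Option.elim_some, Sum.elim_inl]
        omega
      · simp only [Option.elim_some, Sum.elim_inr]
        omega)
    (by
      convert hli using 1
      · funext i
        rcases i with _ | i | i <;> simp
      all_goals rfl)
    ξ (fun o => o.elim (polyHeight (P l) : ℝ)
      (Sum.elim (fun _ => (polyHeight (P k) : ℝ)) (fun _ => (polyHeight (P (k + 1)) : ℝ))))
    (|aeval ξ (P k)| / polyHeight (P k))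
    (by rintro (_ | i | i) <;> simp)
    (by
      rintro (_ | i | i)
      · exact hP.abs_eval_le_ratio hk hkl
      · exact hP.abs_eval_le_ratio hk le_rfl
      · exact hP.abs_eval_le_ratio hk (Nat.le_succ k))
  rw [Fintype.prod_option, Fintype.prod_sum_type] at hdet
  simp only [Option.elim_none, Option.elim_some, Sum.elim_inl, Sum.elim_inr, Finset.prod_const,
    Finset.card_univ, Fintype.card_fin] at hdet
  have hK : ((2 * m + 3).factorial : ℝ) * (1 + |ξ|) ^ (2 * m + 3) ≤
      ((2 * (m + 2)).factorial : ℝ) * (1 + |ξ|) ^ (2 * (m + 2)) := by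
    refine mul_le_mul ?_ (pow_le_pow_right₀ (by linarith [abs_nonneg ξ]) (by omega))
      (by positivity) (by positivity)
    exact_mod_cast Nat.factorial_le (by omega)
  have heq : |aeval ξ (P k)| / polyHeight (P k) * ((polyHeight (P l) : ℝ) *
      ((polyHeight (P k) : ℝ) ^ (m + 1) * (polyHeight (P (k + 1)) : ℝ) ^ (m + 1))) =
      (polyHeight (P k) : ℝ) ^ (m + 2 - 2) * (polyHeight (P (k + 1)) : ℝ) ^ (m + 2 - 1) *
        polyHeight (P l) * |aeval ξ (P k)| := by
    rw [show m + 2 - 2 = m by omega, show m + 2 - 1 = m + 1 by omega]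
    field_simp
    ring
  rw [heq] at hdet
  exact hdet.trans (mul_le_mul_of_nonneg_right hK (by positivity))

/-- Two consecutive best approximations form a basis of the lattice of integer points of the
plane they span. -/
lemma exists_int_of_mem_span (hP : IsBestApproxSeq n ξ P) {k : ℕ} (hk : 1 ≤ k) {Q : ℤ[X]}
    (hQ : ratPoly Q ∈ Submodule.span ℚ {ratPoly (P k), ratPoly (P (k + 1))}) :
    ∃ a b : ℤ, Q = C a * P k + C b * P (k + 1) := by
  obtain ⟨x, y, hxy⟩ := Submodule.mem_span_pair.mp hQ
  have hcoeff : ∀ i, (Q.coeff i : ℝ) = x * (P k).coeff i + y * (P (k + 1)).coeff i := by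
    intro i
    have h := congrArg (fun p : ℚ[X] => ((p.coeff i : ℚ) : ℝ)) hxy
    simpa [ratPoly] using h.symm
  have hev : ∀ R : ℤ[X], aeval ξ (ratPoly R) = aeval ξ R := fun R => by
    simpa [ratPoly] using Polynomial.aeval_map_algebraMap ℚ ξ R
  have heval : aeval ξ Q = x * aeval ξ (P k) + y * aeval ξ (P (k + 1)) := by
    have h := congrArg (fun p : ℚ[X] => aeval ξ p) hxy
    simpa [hev, Polynomial.smul_eq_C_mul] using h.symm
  refine ⟨round x, round y, ?_⟩
  by_contra hne
  set R : ℤ[X] := Q - (C (round x) * P k + C (round y) * P (k + 1)) with hR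
  have hR0 : R ≠ 0 := sub_ne_zero.mpr hne
  have hx : |(x : ℝ) - round x| ≤ 1 / 2 := by
    have h := (Rat.cast_le (K := ℝ)).mpr (abs_sub_round x)
    push_cast at h
    exact h
  have hy : |(y : ℝ) - round y| ≤ 1 / 2 := by
    have h := (Rat.cast_le (K := ℝ)).mpr (abs_sub_round y)
    push_cast at h
    exact h
  have hlt : (polyHeight (P k) : ℝ) < polyHeight (P (k + 1)) := by
    exact_mod_cast hP.height_lt k hk
  have hRc : ∀ i, (R.coeff i : ℝ) =
      (x - round x) * (P k).coeff i + (y - round y) * (P (k + 1)).coeff i := by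
    intro i
    simp only [hR, Polynomial.coeff_sub, Polynomial.coeff_add, Polynomial.coeff_C_mul,
      Int.cast_sub, Int.cast_add, Int.cast_mul, hcoeff]
    ring
  have hRe : aeval ξ R =
      (x - round x) * aeval ξ (P k) + (y - round y) * aeval ξ (P (k + 1)) := by
    simp only [hR, map_sub, map_add, heval, aeval_C_mul_int]
    ring
  have hhalf : ∀ s t A B : ℝ, |(x : ℝ) - round x| ≤ 1 / 2 → |(y : ℝ) - round y| ≤ 1 / 2 →
      |s| ≤ A → |t| ≤ B → |(x - round x) * s + (y - round y) * t| ≤ 1 / 2 * A + 1 / 2 * B := by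
    intro s t A B h1 h2 h3 h4
    refine (abs_add_le _ _).trans ?_
    rw [abs_mul, abs_mul]
    gcongr
  have hRdeg : R.natDegree ≤ n := by
    rw [Polynomial.natDegree_le_iff_coeff_eq_zero]
    intro i hi
    have h1 := Polynomial.coeff_eq_zero_of_natDegree_lt ((hP.deg_le k hk).trans_lt hi)
    have h2 := Polynomial.coeff_eq_zero_of_natDegree_lt ((hP.deg_le (k + 1) (by omega)).trans_lt hi)
    have h3 := hRc i
    rw [h1, h2] at h3
    exact_mod_cast (by simpa using h3 : (R.coeff i : ℝ) = 0)
  have hRH : (polyHeight R : ℝ) ≤ 1 / 2 * polyHeight (P k) + 1 / 2 * polyHeight (P (k + 1)) := by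
    refine polyHeight_le (by positivity) fun i => ?_
    rw [hRc]
    exact hhalf _ _ _ _ hx hy (abs_coeff_le_polyHeight _ _) (abs_coeff_le_polyHeight _ _)
  have hmin := hP.le_eval_of_height_lt hk hR0 hRdeg
    (by exact_mod_cast (by linarith : (polyHeight R : ℝ) < polyHeight (P (k + 1))))
  have hle := hhalf (aeval ξ (P k)) (aeval ξ (P (k + 1))) _ _ hx hy le_rfl le_rfl
  rw [← hRe] at hle
  linarith [hP.eval_lt k hk]

/-- As long as the best approximations remain in one plane, the product `H_{m+1} |P_m(ξ)|` cannot
drop essentially. -/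
lemma height_mul_eval_le (hP : IsBestApproxSeq n ξ P) {k m : ℕ} (hk : 1 ≤ k) (hkm : k ≤ m)
    (hH : 2 * polyHeight (P k) < polyHeight (P (k + 1)))
    (hm : ratPoly (P m) ∈ Submodule.span ℚ {ratPoly (P k), ratPoly (P (k + 1))})
    (hm' : ratPoly (P (m + 1)) ∈ Submodule.span ℚ {ratPoly (P k), ratPoly (P (k + 1))}) :
    (polyHeight (P (k + 1)) : ℝ) * |aeval ξ (P k)| ≤
      4 * (polyHeight (P (m + 1)) * |aeval ξ (P m)|) := by
  obtain ⟨a, b, hab⟩ := hP.exists_int_of_mem_span hk hm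
  obtain ⟨c, d, hcd⟩ := hP.exists_int_of_mem_span hk hm'
  let D : ℕ → ℕ → ℝ := fun j i =>
    aeval ξ (P j) * (P (j + 1)).coeff i - aeval ξ (P (j + 1)) * (P j).coeff i
  have hlow : ∀ j, 1 ≤ j → ∃ i, |aeval ξ (P j)| *
      (polyHeight (P (j + 1)) - polyHeight (P j) : ℝ) ≤ |D j i| := by
    intro j hj
    obtain ⟨i, hi⟩ := exists_abs_coeff_eq_polyHeight (hP.ne_zero (j + 1) (by omega))
    refine ⟨i, le_trans ?_ (abs_sub_abs_le_abs_sub _ _)⟩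
    rw [abs_mul, abs_mul, hi, mul_sub]
    have : |aeval ξ (P (j + 1))| * |((P j).coeff i : ℝ)| ≤ |aeval ξ (P j)| * polyHeight (P j) :=
      mul_le_mul (hP.eval_lt j hj).le (abs_coeff_le_polyHeight _ _) (abs_nonneg _) (abs_nonneg _)
    linarith
  have hD : ∀ i, D m i = ((a * d - b * c : ℤ) : ℝ) * D k i := by
    intro i
    simp only [D, hab, hcd, map_add, aeval_C_mul_int, Polynomial.coeff_add,
      Polynomial.coeff_C_mul]
    push_cast
    ring
  have hm1 : 1 ≤ m := hk.trans hkm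
  have hdet : a * d - b * c ≠ 0 := by
    intro h0
    obtain ⟨i, hi⟩ := hlow m hm1
    rw [hD, h0, Int.cast_zero, zero_mul, abs_zero] at hi
    have h1 : (polyHeight (P m) : ℝ) < polyHeight (P (m + 1)) := by
      exact_mod_cast hP.height_lt m hm1
    have := mul_pos (hP.eval_pos hm1) (sub_pos.mpr h1)
    linarith
  obtain ⟨i, hi⟩ := hlow k hk
  have h1 : |D k i| ≤ |D m i| := by
    rw [hD, abs_mul]
    exact le_mul_of_one_le_left (abs_nonneg _) (by exact_mod_cast Int.one_le_abs hdet)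
  have h2 : |D m i| ≤ 2 * (polyHeight (P (m + 1)) * |aeval ξ (P m)|) := by
    refine (abs_sub _ _).trans ?_
    rw [abs_mul, abs_mul]
    have hmm : (polyHeight (P m) : ℝ) ≤ polyHeight (P (m + 1)) := by
      exact_mod_cast (hP.height_lt m hm1).le
    have e1 : |aeval ξ (P m)| * |((P (m + 1)).coeff i : ℝ)| ≤
        |aeval ξ (P m)| * polyHeight (P (m + 1)) :=
      mul_le_mul_of_nonneg_left (abs_coeff_le_polyHeight _ _) (abs_nonneg _)
    have e2 : |aeval ξ (P (m + 1))| * |((P m).coeff i : ℝ)| ≤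
        |aeval ξ (P m)| * polyHeight (P (m + 1)) :=
      mul_le_mul (hP.eval_lt m hm1).le ((abs_coeff_le_polyHeight _ _).trans hmm) (abs_nonneg _)
        (abs_nonneg _)
    linarith
  have h3 : 2 * (polyHeight (P k) : ℝ) < polyHeight (P (k + 1)) := by exact_mod_cast hH
  nlinarith [mul_nonneg (abs_nonneg (aeval ξ (P k))) (sub_nonneg.mpr h3.le)]

/-! ### Logarithmic form of the estimates -/

lemma tendsto_log_height (hP : IsBestApproxSeq n ξ P) :
    Tendsto (fun k => Real.log (polyHeight (P k))) atTop atTop :=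
  Real.tendsto_log_atTop.comp hP.tendsto_height

lemma eventually_log_eval_le (hP : IsBestApproxSeq n ξ P) {w : ℝ}
    (hw : ∀ v < w, v ∈ uniformExpSet n ξ) {δ : ℝ} (hδ : 0 < δ) :
    ∀ᶠ k in atTop,
      Real.log |aeval ξ (P k)| ≤ -((w - δ) * Real.log (polyHeight (P (k + 1)))) := by
  have ht := ((tendsto_add_atTop_iff_nat 1).mpr hP.tendsto_log_height).eventually_ge_atTop
    (2 * ((w - δ / 2) * Real.log 2) / δ)
  filter_upwards [hP.eventually_eval_lt (hw (w - δ / 2) (by linarith)), ht,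
    eventually_ge_atTop 1] with k hk hL hk1
  have hH : (0 : ℝ) < polyHeight (P (k + 1)) :=
    one_pos.trans_le (one_le_polyHeight (hP.ne_zero (k + 1) (by omega)))
  have h1 := Real.log_le_log (hP.eval_pos hk1) hk.le
  rw [Real.log_rpow (by positivity), Real.log_div hH.ne' two_ne_zero] at h1
  rw [div_le_iff₀ hδ] at hL
  linarith

/-- The best approximations eventually leave the plane spanned by `P_k` and `P_{k+1}`. -/
lemma exists_isGreatest_ellSet (hP : IsBestApproxSeq n ξ P) {w : ℝ} (hw1 : 1 < w)
    (hw : w ∈ uniformExpSet n ξ) {k : ℕ} (hk : 1 ≤ k)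
    (hH : 2 * polyHeight (P k) < polyHeight (P (k + 1))) :
    ∃ l, IsGreatest (ellSet P (k + 1)) l := by
  have hne : (ellSet P (k + 1)).Nonempty := by
    refine ⟨k + 2, le_rfl, fun j hj1 hj2 => Submodule.subset_span ?_⟩
    simp only [Nat.add_sub_cancel] at hj1 hj2 ⊢
    obtain rfl | rfl : j = k ∨ j = k + 1 := by omega
    · exact Set.mem_insert _ _
    · exact Set.mem_insert_of_mem _ rfl
  have hpos : 0 < (polyHeight (P (k + 1)) : ℝ) * |aeval ξ (P k)| :=
    mul_pos (one_pos.trans_le (one_le_polyHeight (hP.ne_zero (k + 1) (by omega))))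
      (hP.eval_pos hk)
  have ht : Tendsto (fun j => (polyHeight (P (j + 1)) : ℝ) / 2) atTop atTop :=
    ((tendsto_add_atTop_iff_nat 1).mpr hP.tendsto_height).atTop_div_const (by norm_num)
  obtain ⟨K, hK⟩ := ((hP.eventually_eval_lt hw).and (ht.eventually
    (eventually_const_mul_rpow_neg_lt (sub_pos.mpr hw1) 8 hpos))).exists_forall_of_atTop
  have hbdd : BddAbove (ellSet P (k + 1)) := by
    refine ⟨K + 2, fun l hl => ?_⟩
    by_contra! hcon
    obtain ⟨hl1, hl2⟩ := hl
    obtain ⟨m, rfl⟩ : ∃ m, l = m + 2 := ⟨l - 2, by omega⟩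
    simp only [Nat.add_sub_cancel] at hl2
    have h1 := hP.height_mul_eval_le hk (show k ≤ m by omega) hH
      (hl2 m (by omega) (by omega)) (hl2 (m + 1) (by omega) (by omega))
    obtain ⟨h2, h3⟩ := hK m (by omega)
    have hY : (0 : ℝ) < (polyHeight (P (m + 1)) : ℝ) / 2 :=
      half_pos (one_pos.trans_le (one_le_polyHeight (hP.ne_zero (m + 1) (by omega))))
    set Y : ℝ := (polyHeight (P (m + 1)) : ℝ) / 2 with hYdef
    have h4 : (polyHeight (P (m + 1)) : ℝ) = 2 * Y := by rw [hYdef]; ring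
    have h5 : Y ^ (-(w - 1)) = Y * Y ^ (-w) := by
      rw [show -(w - 1) = 1 + -w by ring, Real.rpow_add hY, Real.rpow_one]
    rw [h4] at h1
    rw [h5] at h3
    nlinarith [mul_lt_mul_of_pos_left h2 hY]
  exact ⟨_, Nat.sSup_mem hne hbdd, fun l hl => le_csSup hbdd hl⟩

lemma notMem_span_of_isGreatest {k l : ℕ} (hl : IsGreatest (ellSet P k) l) :
    ratPoly (P l) ∉ Submodule.span ℚ {ratPoly (P (k - 1)), ratPoly (P k)} := by
  intro hmem
  have hlt : l + 1 ∈ ellSet P k := by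
    refine ⟨hl.1.1.trans (Nat.le_succ l), fun j hj1 hj2 => ?_⟩
    rcases (show j ≤ l - 1 ∨ j = l by omega) with h | rfl
    · exact hl.1.2 j hj1 h
    · exact hmem
  have := hl.2 hlt
  omega

end IsBestApproxSeq

/-- The cubic inequality as a consequence of the approximate inequalities between `τ` and `σ`. -/
lemma cubic_le_of_approx {n w δ τ σ ε : ℝ} (hn : 2 ≤ n) (hδ0 : 0 < δ) (hδ1 : δ ≤ 1)
    (hδw : δ ≤ (w - n) / 2)
    (hδε : δ * ((1 + 2 * n / (w - n)) * ((w - 1) * (w - n) + w * (2 * n / (w - n)))) ≤ ε)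
    (hτ : 1 ≤ τ) (hσ : 1 ≤ σ) (hτ' : (w - δ - n) * τ ≤ n - 1 + δ)
    (hσ' : (w - δ - n) * σ ≤ n - 1 + δ) (hτσ : τ * (w - n + 1 - δ) - (n - 2) ≤ τ * σ + δ) :
    τ * w ^ 3 - (2 * n * τ + n - 2) * w ^ 2
      + (τ * σ + (n ^ 2 + n - 1) * τ + (1 - n) * σ + n ^ 2 - n - 2) * w
      - n * ((n - 1 + σ) * τ + n - 2) ≤ ε := by
  have hwn0 : 0 < w - n := by linarith
  set T : ℝ := 2 * n / (w - n) with hT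
  have hbound : ∀ t : ℝ, 1 ≤ t → (w - δ - n) * t ≤ n - 1 + δ → t ≤ T := by
    intro t ht h
    rw [hT, le_div_iff₀ hwn0]
    nlinarith [mul_le_mul_of_nonneg_right (show (w - n) / 2 ≤ w - δ - n by linarith)
      (show (0 : ℝ) ≤ t by linarith)]
  have hτT := hbound τ hτ hτ'
  have hσT := hbound σ hσ hσ'
  have hA : (w - n) * τ ≤ n - 1 + δ * (1 + T) := by
    nlinarith [mul_le_mul_of_nonneg_left hτT hδ0.le]
  have hB : τ * (w - n + 1) - (n - 2) ≤ τ * σ + δ * (1 + T) := by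
    nlinarith [mul_le_mul_of_nonneg_left hτT hδ0.le]
  have h1 : (w - 1) * (w - n) * (τ * (w - n + 1) - (n - 2)) ≤
      (w - 1) * (w - n) * (τ * σ + δ * (1 + T)) :=
    mul_le_mul_of_nonneg_left hB (mul_nonneg (by linarith) hwn0.le)
  have h2 : σ * w * ((w - n) * τ) ≤ σ * w * (n - 1 + δ * (1 + T)) :=
    mul_le_mul_of_nonneg_left hA (mul_nonneg (by linarith) (by linarith))
  have h3 : δ * (1 + T) * w * σ ≤ δ * (1 + T) * w * T :=
    mul_le_mul_of_nonneg_left hσT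
      (mul_nonneg (mul_nonneg hδ0.le (by linarith)) (by linarith))
  linarith

/-- The consequence of the resultant bound for the ratio of two consecutive logarithmic heights. -/
lemma IsBestApproxSeq.log_ratio_le {n : ℕ} {ξ : ℝ} {P : ℕ → ℤ[X]} (hP : IsBestApproxSeq n ξ P)
    (hn : 2 ≤ n) {k : ℕ} (hk : 1 ≤ k)
    (hrel : NoRelation (ratPoly (P k)) (ratPoly (P (k + 1))) n n) {w δ : ℝ}
    (hL : 0 < Real.log (polyHeight (P k)))
    (hδL : Real.log (((2 * n).factorial : ℝ) * (1 + |ξ|) ^ (2 * n)) ≤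
      δ * Real.log (polyHeight (P k)))
    (hev : Real.log |aeval ξ (P k)| ≤ -((w - δ) * Real.log (polyHeight (P (k + 1))))) :
    (w - δ - n) * tauk P (k + 1) ≤ n - 1 + δ := by
  have hH := one_le_polyHeight (hP.ne_zero k hk)
  have hH' := one_le_polyHeight (hP.ne_zero (k + 1) (by omega))
  have hpos := hP.eval_pos hk
  have hbound := hP.one_le_resultant_bound (by omega) hk hrel
  have hκ : 0 < ((2 * n).factorial : ℝ) * (1 + |ξ|) ^ (2 * n) := by positivity
  generalize ((2 * n).factorial : ℝ) * (1 + |ξ|) ^ (2 * n) = κ at hκ hbound hδL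
  have h := Real.log_nonneg hbound
  rw [Real.log_mul (by positivity) (by positivity), Real.log_mul (by positivity) (by positivity),
    Real.log_mul (by positivity) (by positivity), Real.log_pow, Real.log_pow,
    Nat.cast_sub (by omega : 1 ≤ n), Nat.cast_one] at h
  rw [tauk, Nat.add_sub_cancel, mul_div_assoc', div_le_iff₀ hL]
  linarith

lemma IsBestApproxSeq.one_le_tauk {n : ℕ} {ξ : ℝ} {P : ℕ → ℤ[X]} (hP : IsBestApproxSeq n ξ P)
    {k : ℕ} (hk : 1 ≤ k) (hL : 0 < Real.log (polyHeight (P k))) : 1 ≤ tauk P (k + 1) := by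
  have hH := one_le_polyHeight (hP.ne_zero k hk)
  rw [tauk, Nat.add_sub_cancel, one_le_div hL]
  exact Real.log_le_log (by linarith) (by exact_mod_cast (hP.height_lt k hk).le)

/-- The consequence of the determinant bound for the ratios of logarithmic heights. -/
lemma IsBestApproxSeq.log_ratio_mul_le {n : ℕ} {ξ : ℝ} {P : ℕ → ℤ[X]}
    (hP : IsBestApproxSeq n ξ P) (hn : 2 ≤ n) {k m : ℕ} (hk : 1 ≤ k) (hkm : k ≤ m)
    (hrel : NoRelation (ratPoly (P k)) (ratPoly (P (k + 1))) n n)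
    (hH : 2 * polyHeight (P k) < polyHeight (P (k + 1)))
    (hl : IsGreatest (ellSet P (k + 1)) (m + 2)) {w δ : ℝ}
    (hL : 0 < Real.log (polyHeight (P k)))
    (hδL : Real.log (((2 * n).factorial : ℝ) * (1 + |ξ|) ^ (2 * n)) + Real.log 4 ≤
      δ * Real.log (polyHeight (P k)))
    (hδ : 0 ≤ δ)
    (hev : Real.log |aeval ξ (P m)| ≤ -((w - δ) * Real.log (polyHeight (P (m + 1))))) :
    tauk P (k + 1) * (w - n + 1 - δ) - (n - 2) ≤ tauk P (k + 1) * tauk P (m + 2) + δ := by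
  have hH1 := one_le_polyHeight (hP.ne_zero k hk)
  have hH2 := one_le_polyHeight (hP.ne_zero (k + 1) (by omega))
  have hH3 := one_le_polyHeight (hP.ne_zero (m + 1) (by omega))
  have hH4 := one_le_polyHeight (hP.ne_zero (m + 2) (by omega))
  have hpos := hP.eval_pos hk
  have hpos' := hP.eval_pos (hk.trans hkm)
  have hnot := notMem_span_of_isGreatest hl
  have hmem := hl.1.2
  simp only [Nat.add_sub_cancel] at hnot hmem
  have hbound := hP.one_le_determinant_bound hn hk (show k ≤ m + 2 by omega) hrel hnot
  have hκ : 0 < ((2 * n).factorial : ℝ) * (1 + |ξ|) ^ (2 * n) := by positivity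
  generalize ((2 * n).factorial : ℝ) * (1 + |ξ|) ^ (2 * n) = κ at hκ hbound hδL
  have hdet := Real.log_nonneg hbound
  rw [Real.log_mul (by positivity) (by positivity), Real.log_mul (by positivity) (by positivity),
    Real.log_mul (by positivity) (by positivity), Real.log_mul (by positivity) (by positivity),
    Real.log_pow, Real.log_pow, Nat.cast_sub hn, Nat.cast_sub (by omega : 1 ≤ n), Nat.cast_one,
    Nat.cast_ofNat] at hdet
  have hplane := Real.log_le_log (by positivity) (hP.height_mul_eval_le hk hkm hH
    (hmem m (by omega) (by omega)) (hmem (m + 1) (by omega) (by omega)))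
  rw [Real.log_mul (by positivity) (by positivity), Real.log_mul (by positivity) (by positivity),
    Real.log_mul (by positivity) (by positivity)] at hplane
  have h12 : Real.log (polyHeight (P k)) ≤ Real.log (polyHeight (P (k + 1))) :=
    Real.log_le_log (by linarith) (by exact_mod_cast (hP.height_lt k hk).le)
  have h23 : Real.log (polyHeight (P (k + 1))) ≤ Real.log (polyHeight (P (m + 1))) :=
    Real.log_le_log (by linarith)
      (by exact_mod_cast hP.height_le_of_le (j := k + 1) (by omega) (by omega))
  simp only [tauk, Nat.add_sub_cancel, show m + 2 - 1 = m + 1 by omega]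
  set a := Real.log (polyHeight (P k))
  set b := Real.log (polyHeight (P (k + 1)))
  set d := Real.log (polyHeight (P (m + 1)))
  set e := Real.log (polyHeight (P (m + 2)))
  have hb : 0 < b := by linarith
  have hd : 0 < d := by linarith
  have hn' : (0 : ℝ) ≤ n - 2 := by
    rw [sub_nonneg]
    exact_mod_cast hn
  have hmain : (w - 1 - δ) * d ≤ δ * a + (n - 2) * (a + b) + e := by linarith
  have hmul : b * ((w - 1 - δ) * d) ≤ δ * a * d + (n - 2) * (a + b) * d + b * e := by
    have h1 := mul_le_mul_of_nonneg_left hmain hb.le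
    have h2 : (δ * a + (n - 2) * (a + b)) * b ≤ (δ * a + (n - 2) * (a + b)) * d :=
      mul_le_mul_of_nonneg_left h23
        (add_nonneg (mul_nonneg hδ hL.le) (mul_nonneg hn' (by linarith)))
    linarith
  have key : b / a * (w - n + 1 - δ) - (n - 2) - (b / a * (e / d) + δ) =
      (b * ((w - 1 - δ) * d) - (δ * a * d + (n - 2) * (a + b) * d + b * e)) / (a * d) := by
    field_simp
    ring
  have hneg : (b * ((w - 1 - δ) * d) - (δ * a * d + (n - 2) * (a + b) * d + b * e)) / (a * d) ≤ 0 :=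
    div_nonpos_of_nonpos_of_nonneg (by linarith) (by positivity)
  linarith

/-- the key cubic inequality `Θ_n ≤ ε` in `w = ŵ_n(ξ)` with coefficients
depending on `n, τ_k, τ_ℓ`. -/
theorem stmt14 (n : ℕ) (hn : 2 ≤ n) (ξ : ℝ)
    (h1 : ((2*(n:ℝ)-2 : ℝ) : EReal) < wHat n ξ) (h2 : wHat n ξ < ⊤)
    (P : ℕ → Polynomial ℤ) (hP : IsBestApproxSeq n ξ P)
    (ε : ℝ) (hε : 0 < ε) :
    ∃ k0 : ℕ, ∀ k ≥ k0, polyHeight (P k) > 2 * polyHeight (P (k-1)) →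
      ∃ ℓ : ℕ, IsGreatest (ellSet P k) ℓ ∧
        tauk P k * (wHat n ξ).toReal^3
        - (2*(n:ℝ)*tauk P k + (n:ℝ) - 2) * (wHat n ξ).toReal^2
        + (tauk P k * tauk P ℓ + ((n:ℝ)^2+(n:ℝ)-1)*tauk P k + (1-(n:ℝ))*tauk P ℓ
            + (n:ℝ)^2 - (n:ℝ) - 2) * (wHat n ξ).toReal
        - (n:ℝ) * (((n:ℝ)-1+tauk P ℓ)*tauk P k + (n:ℝ) - 2) ≤ ε := by
  have hnR : (2 : ℝ) ≤ n := by exact_mod_cast hn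
  set w : ℝ := (wHat n ξ).toReal with hwdef
  have hw : (w : EReal) = wHat n ξ :=
    EReal.coe_toReal h2.ne (((EReal.bot_lt_coe _).trans h1).ne')
  have hw0 : 2 * (n : ℝ) - 2 < w := by
    rw [← hw] at h1
    exact EReal.coe_lt_coe_iff.mp h1
  have hmem : ∀ v < w, v ∈ uniformExpSet n ξ := fun v hv =>
    mem_uniformExpSet_of_lt (hw ▸ EReal.coe_lt_coe_iff.mpr hv)
  obtain ⟨v, hv0, hvw⟩ := exists_between hw0
  have hwn : 0 < w - n := by linarith
  set M : ℝ := (1 + 2 * (n : ℝ) / (w - n)) *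
    ((w - 1) * (w - n) + w * (2 * (n : ℝ) / (w - n))) with hM
  have hMpos : 0 < M := by
    have : 0 < w - 1 := by linarith
    have : 0 < w := by linarith
    positivity
  obtain ⟨δ, hδ0, hδ⟩ : ∃ δ : ℝ, 0 < δ ∧ δ ≤ min 1 (min ((w - n) / 2) (ε / M)) :=
    ⟨_, lt_min one_pos (lt_min (by linarith) (div_pos hε hMpos)), le_rfl⟩
  obtain ⟨hδ1, hδ⟩ := le_min_iff.mp hδ
  obtain ⟨hδw, hδε⟩ := le_min_iff.mp hδ
  rw [le_div_iff₀ hMpos] at hδε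
  set c : ℝ := Real.log (((2 * n).factorial : ℝ) * (1 + |ξ|) ^ (2 * n))
  obtain ⟨K, hK⟩ := ((((hP.eventually_irreducible hn (hmem v hvw) hv0).and
    (hP.eventually_log_eval_le hmem hδ0)).and
    ((hP.tendsto_log_height.eventually_ge_atTop ((c + Real.log 4) / δ)).and
    (hP.tendsto_log_height.eventually_gt_atTop 0))).and
    (eventually_ge_atTop 1)).exists_forall_of_atTop
  refine ⟨K + 1, fun k' hk' hheight => ?_⟩
  obtain ⟨k, rfl⟩ : ∃ k, k' = k + 1 := ⟨k' - 1, by omega⟩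
  have hrel : ∀ j ≥ K, NoRelation (ratPoly (P j)) (ratPoly (P (j + 1))) n n := fun j hj =>
    hP.noRelation (by omega) (hK j hj).2 (hK j hj).1.1.1.1 (hK j hj).1.1.1.2
      (hK (j + 1) (by omega)).1.1.1.1
  have hlarge : ∀ j ≥ K, c + Real.log 4 ≤ δ * Real.log (polyHeight (P j)) := fun j hj => by
    have := (hK j hj).1.2.1
    rwa [div_le_iff₀' hδ0] at this
  have hlog4 : 0 < Real.log 4 := Real.log_pos (by norm_num)
  have hratio : ∀ j ≥ K, (w - δ - n) * tauk P (j + 1) ≤ n - 1 + δ := fun j hj =>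
    hP.log_ratio_le hn (hK j hj).2 (hrel j hj) (hK j hj).1.2.2
      (by linarith [hlarge j hj]) (hK j hj).1.1.2
  have hone : ∀ j ≥ K, 1 ≤ tauk P (j + 1) := fun j hj =>
    hP.one_le_tauk (hK j hj).2 (hK j hj).1.2.2
  have hkK : k ≥ K := by omega
  have hk1 := (hK k hkK).2
  obtain ⟨l, hl⟩ := hP.exists_isGreatest_ellSet (by linarith) (hmem v hvw) hk1 hheight
  refine ⟨l, hl, ?_⟩
  obtain ⟨m, rfl⟩ : ∃ m, l = m + 2 := ⟨l - 2, by have := hl.1.1; omega⟩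
  have hkm : k ≤ m := by
    have := hl.1.1
    omega
  exact cubic_le_of_approx hnR hδ0 hδ1 hδw hδε (hone k hkK) (hone (m + 1) (by omega))
    (hratio k hkK) (hratio (m + 1) (by omega))
    (hP.log_ratio_mul_le hn hk1 hkm (hrel k hkK) hheight hl (hK k hkK).1.2.2 (hlarge k hkK)
      hδ0.le (hK m (by omega)).1.1.2)
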